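/- Let A be a real m×n matrix of full rank k = min(m,n), let 1 ≤ r ≤ k, let S be a nonempty finite set of real numbers, and let H be a random n×r matrix whose entries are i.i.d. random variables sampled uniformly from S. Then the matrix AH has full rank r with probability at least 1 − r/|S|, where |S| is the cardinality of S. -/

import Mathlib

open MeasureTheory

/-- The product measure on `p × q` real matrices (represented as functions `Fin p → Fin q → ℝ`)
whose entries are i.i.d. uniform on the nonempty finite set `S ⊂ ℝ`. -/
noncomputable def uniformMatrix (p q : ℕ) (S : Finset ℝ) (hS : S.Nonempty) :
    Measure (Fin p → Fin q → ℝ) :=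
  Measure.pi fun _ : Fin p => Measure.pi fun _ : Fin q => (PMF.uniformOfFinset S hS).toMeasure

/-- A matrix of rank at least `r` can be compressed to the `r × r` identity matrix. -/
theorem Matrix.exists_mul_mul_eq_one_of_le_rank {K : Type*} [Field K] {m n r : ℕ}
    (A : Matrix (Fin m) (Fin n) K) (hr : r ≤ A.rank) :
    ∃ (B : Matrix (Fin r) (Fin m) K) (E : Matrix (Fin n) (Fin r) K), B * A * E = 1 := by
  obtain ⟨v, hv⟩ := exists_linearIndependent_of_le_finrank (R := K)
    (M := LinearMap.range A.mulVecLin) hr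
  choose e he using fun j => (v j).2
  have hw : LinearIndependent K fun j => (v j : Fin m → K) :=
    hv.map' (LinearMap.range A.mulVecLin).subtype (Submodule.ker_subtype _)
  obtain ⟨g, hg⟩ := LinearMap.exists_leftInverse_of_injective
    (Fintype.linearCombination K fun j => (v j : Fin m → K))
    (LinearMap.ker_eq_bot.2 hw.fintypeLinearCombination_injective)
  refine ⟨LinearMap.toMatrix' g, Matrix.of fun i j => e j i, ?_⟩
  ext i j
  have hgv : g (v j) = Pi.single j 1 := by
    simpa using LinearMap.congr_fun hg (Pi.single j 1)
  have hcol : (LinearMap.toMatrix' g * A * Matrix.of fun i j => e j i) i j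
      = (LinearMap.toMatrix' g).mulVec (A.mulVec (e j)) i := by
    rw [Matrix.mulVec_mulVec]
    rfl
  rw [hcol, ← A.mulVecLin_apply, he, LinearMap.toMatrix'_mulVec, hgv, Matrix.one_apply,
    Pi.single_apply]

/-- The determinant of a matrix of polynomials of degree at most one has degree at most the
size of the matrix. -/
theorem MvPolynomial.totalDegree_det_le_card {σ R ι : Type*} [CommRing R] [Fintype ι]
    [DecidableEq ι] (M : Matrix ι ι (MvPolynomial σ R)) (hM : ∀ i j, (M i j).totalDegree ≤ 1) :
    M.det.totalDegree ≤ Fintype.card ι := by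
  rw [Matrix.det_apply]
  refine MvPolynomial.totalDegree_finsetSum_le fun τ _ => ?_
  rw [Units.smul_def]
  refine (MvPolynomial.totalDegree_smul_le _ _).trans
    ((MvPolynomial.totalDegree_finsetProd _ _).trans ?_)
  exact (Finset.sum_le_sum fun i _ => hM (τ i) i).trans (by simp)

/-- The number of matrices `H` with entries in `S` for which `det (C * H)` vanishes is at most a
fraction `r / |S|` of all such matrices, provided this determinant does not vanish identically. -/
theorem card_filter_det_mul_eq_zero_le {n r : ℕ} (C : Matrix (Fin r) (Fin n) ℝ)
    (E : Matrix (Fin n) (Fin r) ℝ) (hE : (C * E).det ≠ 0) (S : Finset ℝ) :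
    ((Finset.card {H ∈ Fintype.piFinset fun _ : Fin n => Fintype.piFinset fun _ : Fin r => S |
      (C * Matrix.of H).det = 0} : ℕ) : ℝ) / (S.card : ℝ) ^ (n * r) ≤ (r : ℝ) / S.card := by
  let M : Matrix (Fin r) (Fin r) (MvPolynomial (Fin (n * r)) ℝ) := Matrix.of fun i j =>
    ∑ k, MvPolynomial.C (C i k) * MvPolynomial.X (finProdFinEquiv (k, j))
  let f (H : Fin n → Fin r → ℝ) (x : Fin (n * r)) : ℝ :=
    Function.uncurry H (finProdFinEquiv.symm x)
  have heval (H : Fin n → Fin r → ℝ) :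
      MvPolynomial.eval (f H) M.det = (C * Matrix.of H).det := by
    rw [RingHom.map_det]
    congr 1
    ext i j
    simp [M, f, Matrix.mul_apply, -finProdFinEquiv_symm_apply]
  have hdeg : M.det.totalDegree ≤ r := by
    refine (MvPolynomial.totalDegree_det_le_card M fun i j => ?_).trans (by simp)
    simp only [M, Matrix.of_apply]
    refine MvPolynomial.totalDegree_finsetSum_le fun k _ => ?_
    exact (MvPolynomial.totalDegree_mul _ _).trans (by simp)
  have hne : M.det ≠ 0 := by
    intro h
    have h0 := heval E
    rw [h, map_zero] at h0
    exact hE h0.symm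
  have hcard : Finset.card {H ∈ Fintype.piFinset fun _ : Fin n => Fintype.piFinset
      fun _ : Fin r => S | (C * Matrix.of H).det = 0} ≤
      Finset.card {x ∈ Fintype.piFinset fun _ : Fin (n * r) => S |
        MvPolynomial.eval x M.det = 0} := by
    refine Finset.card_le_card_of_injOn f (fun H hH => ?_) fun H _ H' _ h => ?_
    · simp only [Finset.coe_filter, Fintype.mem_piFinset, Set.mem_ofPred_eq] at hH ⊢
      exact ⟨fun x => hH.1 _ _, (heval H).trans hH.2⟩
    · ext i j
      simpa [f, -finProdFinEquiv_symm_apply] using congrFun h (finProdFinEquiv (i, j))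
  have hsz : ((Finset.card {x ∈ Fintype.piFinset fun _ : Fin (n * r) => S |
      MvPolynomial.eval x M.det = 0} : ℕ) : ℝ) / (S.card : ℝ) ^ (n * r) ≤
      (M.det.totalDegree : ℝ) / S.card := by
    have h := (NNRat.cast_le (K := ℝ)).2 (MvPolynomial.schwartz_zippel_totalDegree hne S)
    push_cast at h
    exact h
  calc _ ≤ _ := by gcongr
    _ ≤ _ := hsz
    _ ≤ _ := by gcongr

instance uniformMatrix.isProbabilityMeasure (p q : ℕ) (S : Finset ℝ) (hS : S.Nonempty) :
    IsProbabilityMeasure (uniformMatrix p q S hS) := by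
  unfold uniformMatrix
  infer_instance

/-- Every matrix with entries in `S` has the same probability `|S| ^ (-pq)`. -/
theorem uniformMatrix_singleton {p q : ℕ} {S : Finset ℝ} (hS : S.Nonempty)
    {H : Fin p → Fin q → ℝ} (hH : ∀ i j, H i j ∈ S) :
    (uniformMatrix p q S hS).real {H} = ((S.card : ℝ) ^ (p * q))⁻¹ := by
  have hone (i : Fin p) (j : Fin q) :
      (PMF.uniformOfFinset S hS).toMeasure {H i j} = (S.card : ENNReal)⁻¹ := by
    rw [PMF.toMeasure_apply_singleton _ _ (measurableSet_singleton _),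
      PMF.uniformOfFinset_apply_of_mem _ (hH i j)]
  simp [Measure.real, uniformMatrix, Measure.pi_singleton, hone, pow_mul', inv_pow]

/-- The uniform matrix measure dominates the normalized counting measure on matrices with
entries in `S`. -/
theorem card_div_le_uniformMatrix {p q : ℕ} {S : Finset ℝ} (hS : S.Nonempty)
    (T : Finset (Fin p → Fin q → ℝ)) (hT : ∀ H ∈ T, ∀ i j, H i j ∈ S)
    {U : Set (Fin p → Fin q → ℝ)} (hTU : ↑T ⊆ U) :
    (T.card : ℝ) / (S.card : ℝ) ^ (p * q) ≤ (uniformMatrix p q S hS).real U := by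
  refine le_trans ?_ (measureReal_mono hTU)
  rw [← sum_measureReal_singleton,
    Finset.sum_congr rfl fun H hH => uniformMatrix_singleton hS (hT H hH)]
  simp [div_eq_mul_inv]

/-- Let `A` be a real `m×n` matrix of full rank `min(m,n)`, let `1 ≤ r ≤ min(m,n)`,
let `S` be a nonempty finite set of reals, and let `H` be a random `n×r` matrix with i.i.d. entries
uniform on `S`.  Then `A*H` has full rank `r` with probability at least `1 - r/|S|`. -/
theorem stmt9 {m n r : ℕ} (hr1 : 1 ≤ r) (hrk : r ≤ min m n)
    (A : Matrix (Fin m) (Fin n) ℝ) (hA : A.rank = min m n)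
    (S : Finset ℝ) (hS : S.Nonempty) :
    1 - (r : ℝ) / S.card ≤
      ((uniformMatrix n r S hS) {H | (A * Matrix.of H).rank = r}).toReal := by
  obtain ⟨B, E, hBE⟩ := A.exists_mul_mul_eq_one_of_le_rank (hA ▸ hrk)
  let T : Finset (Fin n → Fin r → ℝ) :=
    Fintype.piFinset fun _ : Fin n => Fintype.piFinset fun _ : Fin r => S
  have hsplit := Finset.card_filter_add_card_filter_not (s := T)
    (fun H => (B * A * Matrix.of H).det = 0)
  have hTcard : T.card = S.card ^ (n * r) := by simp [T, pow_mul']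
  have hbad := card_filter_det_mul_eq_zero_le (B * A) E (by simp [hBE]) S
  have hgood := card_div_le_uniformMatrix hS {H ∈ T | ¬ (B * A * Matrix.of H).det = 0}
    (U := {H | (A * Matrix.of H).rank = r})
    (fun H hH i j => by
      have h := (Finset.mem_filter.1 hH).1
      simp only [T, Fintype.mem_piFinset] at h
      exact h i j)
    (fun H hH => by
      have h : (B * A * Matrix.of H).det ≠ 0 := (Finset.mem_filter.1 hH).2
      refine le_antisymm (by simpa using (A * Matrix.of H).rank_le_width) ?_
      have hrank := Matrix.rank_of_isUnit _
        ((Matrix.isUnit_iff_isUnit_det _).2 (isUnit_iff_ne_zero.2 h))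
      rw [Matrix.mul_assoc, Fintype.card_fin] at hrank
      exact hrank.symm.le.trans (Matrix.rank_mul_le_right _ _))
  refine le_trans ?_ hgood
  have hpos : (0 : ℝ) < (S.card : ℝ) ^ (n * r) := by
    have := hS.card_pos
    positivity
  have hsum : ((Finset.card {H ∈ T | (B * A * Matrix.of H).det = 0} : ℕ) : ℝ) +
      (Finset.card {H ∈ T | ¬ (B * A * Matrix.of H).det = 0} : ℕ) = (S.card : ℝ) ^ (n * r) := by
    exact_mod_cast hsplit.trans hTcard
  have hone := div_self hpos.ne'
  nth_rewrite 1 [← hsum] at hone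
  rw [add_div] at hone
  linarith
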